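/- Let a < n be coprime positive integers with n > 1. The interior hull P_{a,n}^{(1)} is a clean lattice polygon (i.e., every lattice point on its boundary is one of its extreme points) if and only if there is an index m such that n = F_m and either a = F_{m−1} or a = F_{m−2}, where F_k denotes the k-th Fibonacci number (F_1 = F_2 = 1, F_{k+2} = F_{k+1} + F_k). -/

import Mathlib

/-- The set of lattice points of `ℝ²`. -/
def latt : Set (ℝ × ℝ) := {p | ∃ z : ℤ × ℤ, p = ((z.1 : ℝ), (z.2 : ℝ))}

/-- The clean lattice parallelogram with vertices `(0,0), (1,0), (a,n), (a+1,n)`. -/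
noncomputable def Pan (a n : ℕ) : Set (ℝ × ℝ) :=
  convexHull ℝ ({(0, 0), (1, 0), ((a : ℝ), (n : ℝ)), ((a : ℝ) + 1, (n : ℝ))} : Set (ℝ × ℝ))

/-! ### Convexity -/

theorem Convex.exists_forall_le_of_notMem_interior {E : Type*} [NormedAddCommGroup E]
    [NormedSpace ℝ E] [FiniteDimensional ℝ E] {C : Set E} (hC : Convex ℝ C) {p : E}
    (hpC : p ∈ C) (hp : p ∉ interior C) :
    ∃ f : E →L[ℝ] ℝ, f ≠ 0 ∧ ∀ x ∈ C, f p ≤ f x := by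
  rcases (interior C).eq_empty_or_nonempty with he | hne
  · have hspan : affineSpan ℝ C ≠ ⊤ := by
      intro h
      have := hC.interior_nonempty_iff_affineSpan_eq_top.2 h
      simp [he] at this
    have hdir : vectorSpan ℝ C < ⊤ := by
      rw [lt_top_iff_ne_top, ← direction_affineSpan]
      intro h
      exact hspan ((AffineSubspace.direction_eq_top_iff_of_nonempty
        ((affineSpan_nonempty ℝ).2 ⟨p, hpC⟩)).1 h)
    obtain ⟨f, hf0, hf⟩ := Submodule.exists_le_ker_of_lt_top _ hdir
    refine ⟨LinearMap.toContinuousLinearMap f, by simpa using hf0, fun x hx => ?_⟩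
    have h1 : f (x - p) = 0 := hf (vsub_mem_vectorSpan ℝ hx hpC)
    rw [map_sub, sub_eq_zero] at h1
    simp [h1]
  · obtain ⟨f, hf⟩ := geometric_hahn_banach_open_point hC.interior isOpen_interior hp
    obtain ⟨b, hb⟩ := hne
    refine ⟨-f, ?_, fun x hx => ?_⟩
    · intro h
      have h0 : f = 0 := neg_eq_zero.1 h
      have := hf b hb
      simp [h0] at this
    · have hx' : x ∈ closure (interior C) := by
        rw [hC.closure_interior_eq_closure_of_nonempty_interior ⟨b, hb⟩]
        exact subset_closure hx
      have hle : closure (interior C) ⊆ {y | f y ≤ f p} :=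
        closure_minimal (fun y hy => (hf y hy).le) (isClosed_le f.continuous continuous_const)
      simpa using hle hx'

theorem mem_extremePoints_convexHull_of_forall_lt {E : Type*} [AddCommGroup E] [Module ℝ E]
    {S : Set E} {p : E} (hp : p ∈ S) (f : E →ₗ[ℝ] ℝ) (h : ∀ v ∈ S, v ≠ p → f p < f v) :
    p ∈ Set.extremePoints ℝ (convexHull ℝ S) := by
  have hK : Convex ℝ {x | f p < f x ∨ x = p} := by
    rintro x hx y hy s t hs ht hst
    have hx' : f p ≤ f x := hx.elim le_of_lt fun h => by rw [h]
    have hy' : f p ≤ f y := hy.elim le_of_lt fun h => by rw [h]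
    simp only [Set.mem_ofPred_eq, map_add, map_smul, smul_eq_mul]
    rcases hs.eq_or_lt with rfl | hs
    · obtain rfl : t = 1 := by linarith
      simpa using hy
    rcases ht.eq_or_lt with rfl | ht
    · obtain rfl : s = 1 := by linarith
      simpa using hx
    have hsplit : ∀ c : ℝ, c = s * c + t * c := fun c => by rw [← add_mul, hst, one_mul]
    rcases hx with hx | rfl
    · left
      rw [hsplit (f p)]
      exact add_lt_add_of_lt_of_le (mul_lt_mul_of_pos_left hx hs)
        (mul_le_mul_of_nonneg_left hy' ht.le)
    rcases hy with hy | rfl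
    · left
      conv_lhs => rw [hsplit (f x)]
      gcongr
    · right
      rw [← add_smul, hst, one_smul]
  have hS : convexHull ℝ S ⊆ {x | f p < f x ∨ x = p} :=
    convexHull_min (fun v hv => (em (v = p)).symm.imp (h v hv) id) hK
  refine mem_extremePoints.2 ⟨subset_convexHull ℝ S hp, fun x hx y hy hxy => ?_⟩
  obtain ⟨s, t, hs, ht, hst, rfl⟩ := hxy
  have hx' := hS hx
  have hy' := hS hy
  set q := s • x + t • y with hq
  have hfq : f q = s * f x + t * f y := by simp [hq]
  have hsum : s * (f x - f q) + t * (f y - f q) = 0 := by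
    linear_combination (-f q) * hst - hfq
  have hx0 : 0 ≤ f x - f q := hx'.elim (fun h => by linarith) fun h => by rw [h]; simp
  have hy0 : 0 ≤ f y - f q := hy'.elim (fun h => by linarith) fun h => by rw [h]; simp
  have hx1 : ¬ f q < f x := fun h => by
    have := mul_pos hs (sub_pos.2 h)
    have := mul_nonneg ht.le hy0
    linarith
  have hy1 : ¬ f q < f y := fun h => by
    have := mul_pos ht (sub_pos.2 h)
    have := mul_nonneg hs.le hx0
    linarith
  exact ⟨hx'.resolve_left hx1, hy'.resolve_left hy1⟩

/-! ### Lattice points of the open parallelogram -/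

/-- The interior lattice points `(X, Y)` of `Pan a n` in the coordinates
`j = Y`, `k = n X - a Y`: points of the open square of side `n` with `k ≡ -a j` modulo `n`. -/
def IsSquarePoint (n a j k : ℤ) : Prop :=
  0 < j ∧ j < n ∧ 0 < k ∧ k < n ∧ n ∣ k + a * j

/-- `α j + β k` attains its minimum over all square points at `(j, k)`. -/
def IsMinimizer (n a : ℤ) (α β : ℝ) (j k : ℤ) : Prop :=
  ∀ j' k', IsSquarePoint n a j' k' → α * j + β * k ≤ α * j' + β * k'

theorem IsSquarePoint.neg_right {n a j k : ℤ} (h : IsSquarePoint n a j k) :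
    IsSquarePoint n (-a) j (n - k) := by
  obtain ⟨h1, h2, h3, h4, h5⟩ := h
  refine ⟨h1, h2, by omega, by omega, ?_⟩
  have : n - k + -a * j = n - (k + a * j) := by ring
  rw [this]
  exact dvd_sub_self_left.2 h5

theorem IsSquarePoint.symm {n a j k : ℤ} (h : IsSquarePoint n a j k) :
    IsSquarePoint n a (n - j) (n - k) := by
  obtain ⟨h1, h2, h3, h4, c, hc⟩ := h
  exact ⟨by omega, by omega, by omega, by omega, 1 + a - c, by linear_combination -hc⟩

theorem IsMinimizer.neg_right {n a : ℤ} {α β : ℝ} {j k : ℤ} (h : IsMinimizer n a α β j k) :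
    IsMinimizer n (-a) α (-β) j (n - k) := by
  intro j' k' h'
  have := h j' (n - k') (by simpa using h'.neg_right)
  push_cast at this ⊢
  linarith

theorem IsMinimizer.symm {n a : ℤ} {α β : ℝ} {j k : ℤ} (h : IsMinimizer n a α β j k) :
    IsMinimizer n a (-α) (-β) (n - j) (n - k) := by
  intro j' k' h'
  have := h _ _ h'.symm
  push_cast at this ⊢
  linarith

theorem interior_Pan (a n : ℕ) (hn : 0 < n) :
    interior (Pan a n) =
      {p : ℝ × ℝ | 0 < p.2 ∧ p.2 < n ∧ 0 < n * p.1 - a * p.2 ∧ n * p.1 - a * p.2 < n} := by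
  have hn' : (0 : ℝ) < n := by exact_mod_cast hn
  let g : ℝ × ℝ →ₗ[ℝ] ℝ := (n : ℝ) • LinearMap.fst ℝ ℝ ℝ - (a : ℝ) • LinearMap.snd ℝ ℝ ℝ
  have hg : ∀ p, g p = n * p.1 - a * p.2 := fun p => by simp [g]
  have hgs : Function.Surjective g := fun c => ⟨(c / n, 0), by
    rw [hg]
    field_simp
    ring⟩
  have hgo : IsOpenMap g := g.isOpenMap_of_finiteDimensional hgs
  have hgc : Continuous g := g.continuous_of_finiteDimensional
  have hPan : Pan a n = Prod.snd ⁻¹' Set.Icc (0 : ℝ) n ∩ g ⁻¹' Set.Icc (0 : ℝ) n := by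
    apply Set.Subset.antisymm
    · apply convexHull_min
      · rintro p hp
        simp only [Set.mem_insert_iff, Set.mem_singleton_iff] at hp
        simp only [Set.mem_inter_iff, Set.mem_preimage, hg, Set.mem_Icc]
        rcases hp with rfl | rfl | rfl | rfl <;> refine ⟨⟨?_, ?_⟩, ?_, ?_⟩ <;> nlinarith
      · exact ((convex_Icc (0 : ℝ) n).linear_preimage (LinearMap.snd ℝ ℝ ℝ)).inter
          ((convex_Icc (0 : ℝ) n).linear_preimage g)
    · rintro ⟨x, y⟩ ⟨hy, hx⟩
      simp only [Set.mem_preimage, hg, Set.mem_Icc] at hx hy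
      set u : ℝ := y / n with hu
      set v : ℝ := (n * x - a * y) / n with hv
      have hu0 : 0 ≤ u := div_nonneg hy.1 hn'.le
      have hu1 : u ≤ 1 := (div_le_one hn').2 hy.2
      have hv0 : 0 ≤ v := div_nonneg hx.1 hn'.le
      have hv1 : v ≤ 1 := (div_le_one hn').2 hx.2
      have hC := convex_convexHull ℝ
        ({(0, 0), (1, 0), ((a : ℝ), (n : ℝ)), ((a : ℝ) + 1, (n : ℝ))} : Set (ℝ × ℝ))
      have hsub := subset_convexHull ℝ
        ({(0, 0), (1, 0), ((a : ℝ), (n : ℝ)), ((a : ℝ) + 1, (n : ℝ))} : Set (ℝ × ℝ))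
      have b1 := hC (hsub (by simp : ((0 : ℝ), (0 : ℝ)) ∈ _))
        (hsub (by simp : ((1 : ℝ), (0 : ℝ)) ∈ _)) (sub_nonneg.2 hv1) hv0 (by ring)
      have b2 := hC (hsub (by simp : ((a : ℝ), (n : ℝ)) ∈ _))
        (hsub (by simp : ((a : ℝ) + 1, (n : ℝ)) ∈ _)) (sub_nonneg.2 hv1) hv0 (by ring)
      have b3 := hC b1 b2 (sub_nonneg.2 hu1) hu0 (by ring)
      have hyu : y = u * n := by rw [hu]; field_simp
      have hxv : x = v + a * u := by rw [hu, hv]; field_simp; ring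
      unfold Pan
      convert b3 using 1
      ext
      · simp only [Prod.smul_mk, Prod.mk_add_mk, smul_eq_mul]
        rw [hxv]
        ring
      · simp only [Prod.smul_mk, Prod.mk_add_mk, smul_eq_mul]
        rw [hyu]
        ring
  rw [hPan, interior_inter, ← isOpenMap_snd.preimage_interior_eq_interior_preimage continuous_snd,
    ← hgo.preimage_interior_eq_interior_preimage hgc, interior_Icc]
  ext p
  simp only [Set.mem_inter_iff, Set.mem_preimage, Set.mem_Ioo, Set.mem_ofPred_eq, hg, and_assoc]

theorem intCast_mem_interior_Pan_iff (a n : ℕ) (hn : 0 < n) (X Y : ℤ) :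
    ((X : ℝ), (Y : ℝ)) ∈ interior (Pan a n) ↔ IsSquarePoint n a Y (n * X - a * Y) := by
  rw [interior_Pan a n hn, IsSquarePoint]
  have : (n : ℤ) ∣ n * X - a * Y + a * Y := ⟨X, by ring⟩
  simp only [Set.mem_ofPred_eq, this, and_true]
  norm_cast

theorem exists_eq_of_isSquarePoint {a n : ℕ} (hn : 0 < n) {j k : ℤ}
    (h : IsSquarePoint n a j k) :
    ∃ X : ℤ, k = n * X - a * j ∧ ((X : ℝ), (j : ℝ)) ∈ interior (Pan a n) ∩ latt := by
  obtain ⟨X, hX⟩ := h.2.2.2.2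
  obtain rfl : k = n * X - a * j := by linear_combination hX
  exact ⟨X, rfl, (intCast_mem_interior_Pan_iff a n hn X j).2 h, (X, j), rfl⟩

theorem finite_interior_Pan_inter_latt (a n : ℕ) (hn : 0 < n) :
    (interior (Pan a n) ∩ latt).Finite := by
  refine (((Set.finite_Icc (0 : ℤ) (a + 1)).prod (Set.finite_Icc (0 : ℤ) n)).image
    fun z : ℤ × ℤ => ((z.1 : ℝ), (z.2 : ℝ))).subset ?_
  rintro _ ⟨hp, ⟨X, Y⟩, rfl⟩
  obtain ⟨h1, h2, h3, h4, -⟩ := (intCast_mem_interior_Pan_iff a n hn X Y).1 hp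
  have hn' : (0 : ℤ) < n := by exact_mod_cast hn
  have ha' : (0 : ℤ) ≤ a := by positivity
  refine ⟨(X, Y), ⟨⟨?_, ?_⟩, h1.le, h2.le⟩, rfl⟩ <;> simp only
  · by_contra! h
    nlinarith [mul_nonneg ha' h1.le]
  · by_contra! h
    nlinarith [mul_nonneg ha' (sub_nonneg.2 h2.le)]

theorem clean_of_forall_exposed {a n : ℕ} (hn : 0 < n)
    (H : ∀ j k, IsSquarePoint n a j k → ∀ α β : ℝ, (α ≠ 0 ∨ β ≠ 0) → IsMinimizer n a α β j k →
      ∃ γ δ : ℝ, ∀ j' k', IsSquarePoint n a j' k' → (j' ≠ j ∨ k' ≠ k) →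
        γ * j + δ * k < γ * j' + δ * k') :
    ∀ p ∈ frontier (convexHull ℝ (interior (Pan a n) ∩ latt)), p ∈ latt →
        p ∈ Set.extremePoints ℝ (convexHull ℝ (interior (Pan a n) ∩ latt)) := by
  intro p hp hpl
  have hn' : (n : ℝ) ≠ 0 := by positivity
  have hfin := finite_interior_Pan_inter_latt a n hn
  have hpC : p ∈ convexHull ℝ (interior (Pan a n) ∩ latt) :=
    (hfin.isClosed_convexHull ℝ).frontier_subset hp
  have hpP : p ∈ interior (Pan a n) :=
    convexHull_min Set.inter_subset_left (convex_convexHull ℝ _).interior hpC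
  obtain ⟨f, hf0, hf⟩ := (convex_convexHull ℝ _).exists_forall_le_of_notMem_interior hpC hp.2
  obtain ⟨⟨X, Y⟩, rfl⟩ := hpl
  have hfe : ∀ x y : ℝ, f (x, y) =
      (f (0, 1) + f (1, 0) * a / n) * y + f (1, 0) / n * (n * x - a * y) := by
    intro x y
    have : f (x, y) = x * f (1, 0) + y * f (0, 1) := by
      rw [← smul_eq_mul, ← smul_eq_mul, ← map_smul, ← map_smul, ← map_add]
      simp
    rw [this]
    field_simp
    ring
  obtain ⟨γ, δ, hs⟩ := H Y (n * X - a * Y) ((intCast_mem_interior_Pan_iff a n hn X Y).1 hpP)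
    (f (0, 1) + f (1, 0) * a / n) (f (1, 0) / n) (by
      by_contra! h
      apply hf0
      refine ContinuousLinearMap.ext fun q => (hfe q.1 q.2).trans ?_
      rw [h.1, h.2]
      simp) (by
      intro j' k' h'
      obtain ⟨X', rfl, hX'⟩ := exists_eq_of_isSquarePoint hn h'
      have := hf _ (subset_convexHull ℝ _ hX')
      rw [hfe X Y, hfe X' j'] at this
      push_cast
      exact this)
  refine mem_extremePoints_convexHull_of_forall_lt ⟨hpP, (X, Y), rfl⟩
    (γ • LinearMap.snd ℝ ℝ ℝ +
      δ • ((n : ℝ) • LinearMap.fst ℝ ℝ ℝ - (a : ℝ) • LinearMap.snd ℝ ℝ ℝ)) ?_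
  rintro _ ⟨hv, ⟨X', Y'⟩, rfl⟩ hne
  have := hs Y' (n * X' - a * Y') ((intCast_mem_interior_Pan_iff a n hn X' Y').1 hv) (by
    by_contra! h
    obtain ⟨rfl, h⟩ := h
    have hX : X' = X := by
      have hn0 : (n : ℤ) ≠ 0 := by positivity
      exact mul_left_cancel₀ hn0 (by linarith)
    exact hne (by rw [hX]))
  push_cast at this
  simpa using this

theorem eq_of_clean {a n : ℕ} (hn : 0 < n)
    (hclean : ∀ p ∈ frontier (convexHull ℝ (interior (Pan a n) ∩ latt)), p ∈ latt →
        p ∈ Set.extremePoints ℝ (convexHull ℝ (interior (Pan a n) ∩ latt)))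
    {j k d e : ℤ} (hp : IsSquarePoint n a j k) {α β : ℝ} (h0 : α ≠ 0 ∨ β ≠ 0)
    (hmin : IsMinimizer n a α β j k) (h1 : IsSquarePoint n a (j - d) (k - e))
    (h2 : IsSquarePoint n a (j + d) (k + e)) : d = 0 := by
  have hn' : (n : ℝ) ≠ 0 := by positivity
  obtain ⟨X, hX, hXm⟩ := exists_eq_of_isSquarePoint hn hp
  obtain ⟨X₁, hX₁, hXm₁⟩ := exists_eq_of_isSquarePoint hn h1
  obtain ⟨X₂, hX₂, hXm₂⟩ := exists_eq_of_isSquarePoint hn h2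
  set C := convexHull ℝ (interior (Pan a n) ∩ latt) with hC
  let f : ℝ × ℝ →L[ℝ] ℝ := LinearMap.toContinuousLinearMap (α • LinearMap.snd ℝ ℝ ℝ +
      β • ((n : ℝ) • LinearMap.fst ℝ ℝ ℝ - (a : ℝ) • LinearMap.snd ℝ ℝ ℝ))
  have hfe : ∀ p, f p = α * p.2 + β * (n * p.1 - a * p.2) := fun p => by simp [f]
  have hle : C ⊆ {x | f ((X : ℝ), (j : ℝ)) ≤ f x} := by
    refine convexHull_min ?_ (convex_halfSpace_ge f.isBoundedLinearMap.toIsLinearMap _)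
    rintro _ ⟨hv, ⟨X', Y'⟩, rfl⟩
    have := hmin Y' (n * X' - a * Y') ((intCast_mem_interior_Pan_iff a n hn X' Y').1 hv)
    rw [hX] at this
    push_cast at this
    simpa [hfe] using this
  have hnot : ((X : ℝ), (j : ℝ)) ∉ interior C := by
    intro hi
    have hloc : IsLocalMin f ((X : ℝ), (j : ℝ)) := by
      filter_upwards [mem_interior_iff_mem_nhds.1 hi] with x hx using hle hx
    have hz := hloc.hasFDerivAt_eq_zero f.hasFDerivAt
    have e1 : f (1, 0) = 0 := by rw [hz]; rfl
    have e2 : f (0, 1) = 0 := by rw [hz]; rfl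
    rw [hfe] at e1 e2
    have hβ : β = 0 := by simpa [hn'] using e1
    have hα : α = 0 := by simpa [hβ] using e2
    exact h0.elim (· hα) (· hβ)
  have hext := hclean ((X : ℝ), (j : ℝ))
    ⟨subset_closure (subset_convexHull ℝ _ hXm), hnot⟩ hXm.2
  have hXX : 2 * X = X₁ + X₂ := by
    have hn0 : (n : ℤ) ≠ 0 := by positivity
    refine mul_left_cancel₀ hn0 ?_
    linear_combination hX₁ + hX₂ - 2 * hX
  have hXX' : (2 : ℝ) * X = X₁ + X₂ := by exact_mod_cast hXX
  have := (mem_extremePoints.1 hext).2 _ (subset_convexHull ℝ _ hXm₁) _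
    (subset_convexHull ℝ _ hXm₂) ⟨1 / 2, 1 / 2, by norm_num, by norm_num, by norm_num, by
      ext
      · simp only [Prod.smul_mk, Prod.mk_add_mk, smul_eq_mul]
        linarith
      · simp only [Prod.smul_mk, Prod.mk_add_mk, smul_eq_mul]
        push_cast
        ring⟩
  have hd := congrArg Prod.snd this.1
  simp only [Int.cast_sub] at hd
  have : (d : ℝ) = 0 := by linarith
  exact_mod_cast this

/-! ### Clean interior hulls come from Fibonacci numbers -/

/-- No square point that minimizes a nonzero linear form is the midpoint of two other ones. -/
def NoFlatPoint (n a : ℤ) : Prop :=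
  ∀ j k d e : ℤ, IsSquarePoint n a j k → ∀ α β : ℝ, (α ≠ 0 ∨ β ≠ 0) →
    IsMinimizer n a α β j k → IsSquarePoint n a (j - d) (k - e) →
    IsSquarePoint n a (j + d) (k + e) → d = 0

theorem NoFlatPoint.neg {n a : ℤ} (h : NoFlatPoint n a) : NoFlatPoint n (-a) := by
  intro j k d e hp α β h0 hmin h1 h2
  refine h j (n - k) d (-e) (by simpa using hp.neg_right) α (-β) (by simpa using h0)
    (by simpa using hmin.neg_right) ?_ ?_
  · have := h1.neg_right
    rw [neg_neg] at this
    convert this using 1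
    ring
  · have := h2.neg_right
    rw [neg_neg] at this
    convert this using 1
    ring

theorem NoFlatPoint.le_two_mul {n a x y x' y' : ℤ} (h : NoFlatPoint n a) (hx : 0 < x)
    (hx' : 0 < x') (hy' : 0 < y') (h1 : n ∣ y + a * x) (h2 : n ∣ y' - a * x')
    (hdet : x * y' + x' * y = n) : y ≤ 2 * y' := by
  by_contra! hlt
  have hy : 0 < y := by linarith
  have hxn : x + 2 * x' < n := by nlinarith
  have hyn : y < n := by nlinarith
  obtain ⟨c, hc⟩ := h1
  obtain ⟨c', hc'⟩ := h2
  have hmin : IsMinimizer n a (y' : ℝ) (x' : ℝ) (x + x') (y - y') := by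
    rintro j k ⟨hj, -, hk, -, t, ht⟩
    have hdvd : j * y' + k * x' = n * (j * c' + x' * t) := by
      linear_combination j * hc' + x' * ht
    have hn : 0 < n := by linarith
    have hpos : 0 < n * (j * c' + x' * t) := by
      rw [← hdvd]
      positivity
    have hge : 1 ≤ j * c' + x' * t := pos_of_mul_pos_right hpos hn.le
    have hfin : y' * (x + x') + x' * (y - y') ≤ y' * j + x' * k := by
      have : n * 1 ≤ n * (j * c' + x' * t) := mul_le_mul_of_nonneg_left hge hn.le
      linarith
    exact_mod_cast hfin
  have hzero := h (x + x') (y - y') x' (-y')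
    ⟨by linarith, by linarith, by linarith, by linarith, c - c', by linear_combination hc - hc'⟩
    y' x' (Or.inl (by exact_mod_cast hy'.ne')) hmin
    ⟨by linarith, by linarith, by linarith, by linarith, c, by linear_combination hc⟩
    ⟨by linarith, by linarith, by linarith, by linarith, c - 2 * c',
      by linear_combination hc - 2 * hc'⟩
  exact hx'.ne' hzero

theorem NoFlatPoint.exists_fib (n : ℤ) (y : ℕ) : ∀ (a x x' : ℤ) (y' : ℕ), NoFlatPoint n a →
    0 < x → 0 < x' → 0 < y' → y' < y → n ∣ y + a * x → n ∣ y' - a * x' →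
    x * y' + x' * y = n → Nat.Coprime y y' →
    ∃ r, y = Nat.fib (r + 1) ∧ y' = Nat.fib r := by
  induction y using Nat.strong_induction_on with
  | _ y ih =>
    intro a x x' y' h hx hx' hy' hlt h1 h2 hdet hco
    have hle : y ≤ 2 * y' := by
      exact_mod_cast h.le_two_mul hx hx' (by exact_mod_cast hy') h1 h2 hdet
    rcases hle.eq_or_lt with heq | hlt2
    · subst heq
      obtain rfl : y' = 1 := Nat.Coprime.eq_one_of_dvd hco.symm (Dvd.intro_left 2 rfl)
      exact ⟨2, by decide, by decide⟩
    · obtain ⟨z, rfl⟩ := Nat.exists_eq_add_of_lt hlt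
      obtain ⟨c, hc⟩ := h1
      obtain ⟨c', hc'⟩ := h2
      push_cast at hc hdet
      obtain ⟨r, hr1, hr2⟩ := ih y' hlt (-a) x' (x + x') (z + 1) h.neg hx' (by linarith)
        (by omega) (by omega) ⟨c', by linear_combination hc'⟩
        ⟨c - c', by push_cast; linear_combination hc - hc'⟩
        (by push_cast; linear_combination hdet)
        (by rw [add_assoc, Nat.coprime_self_add_left] at hco; exact hco.symm)
      exact ⟨r + 1, by rw [Nat.fib_add_two, ← hr1, ← hr2]; ring, hr1⟩

theorem NoFlatPoint.exists_eq_fib {a n : ℕ} (ha : 0 < a) (han : a < n) (hco : Nat.Coprime a n)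
    (h : NoFlatPoint n a) :
    ∃ m : ℕ, n = Nat.fib m ∧ (a = Nat.fib (m - 1) ∨ a = Nat.fib (m - 2)) := by
  obtain ⟨b, rfl⟩ := Nat.exists_eq_add_of_lt han
  have hco' : Nat.Coprime (b + 1) a := by
    rw [add_assoc, Nat.coprime_self_add_right] at hco
    exact hco.symm
  rcases lt_trichotomy a (b + 1) with hlt | heq | hgt
  · obtain ⟨r, h1, h2⟩ := h.exists_fib _ (b + 1) a 1 1 a one_pos one_pos ha hlt
      ⟨1, by push_cast; ring⟩ ⟨0, by ring⟩ (by push_cast; ring) hco'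
    exact ⟨r + 2, by rw [Nat.fib_add_two, ← h1, ← h2]; ring, Or.inr h2⟩
  · obtain rfl : a = 1 := by simpa [← heq] using hco'
    obtain rfl : b = 0 := by omega
    exact ⟨3, by decide, Or.inl (by decide)⟩
  · obtain ⟨r, h1, h2⟩ := h.neg.exists_fib _ a (-a) 1 1 (b + 1) one_pos one_pos (by omega) hgt
      ⟨0, by ring⟩ ⟨1, by push_cast; ring⟩ (by push_cast; ring) hco'.symm
    exact ⟨r + 2, by rw [Nat.fib_add_two, ← h1, ← h2]; ring, Or.inl h1⟩

/-! ### Fibonacci parallelograms have a clean interior hull -/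

theorem fib_dvd_fib_add (i : ℕ) : ∀ r : ℕ,
    (Nat.fib (i + r + 1) : ℤ) ∣ Nat.fib (r + 1) + (-1) ^ i * Nat.fib (i + r) * Nat.fib i := by
  induction i using Nat.twoStepInduction with
  | zero => intro r; simp
  | one =>
    intro r
    simp [add_comm 1 r]
  | more i ih1 ih2 =>
    intro r
    have h1 := ih1 (r + 2)
    have h2 := ih2 (r + 1)
    rw [show i + 1 + (r + 1) = i + 2 + r by ring] at h2
    rw [show i + (r + 2) = i + 2 + r by ring] at h1
    obtain ⟨c, hc⟩ := dvd_sub h1 h2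
    refine ⟨c, hc ▸ ?_⟩
    rw [Nat.fib_add_two (n := i), show r + 2 + 1 = (r + 1) + 2 by ring,
      Nat.fib_add_two (n := r + 1)]
    push_cast
    ring

theorem fib_dvd_fib_add' {m i r : ℕ} (hm : 0 < m) (h : i + r = m) :
    (Nat.fib m : ℤ) ∣ Nat.fib r + (-1) ^ i * Nat.fib (m - 1) * Nat.fib i := by
  cases r with
  | zero =>
    obtain rfl : i = m := by omega
    simp
  | succ r =>
    subst h
    exact fib_dvd_fib_add i r

theorem fib_add_two_mul_sub (i r : ℕ) :
    (Nat.fib (i + 2) * Nat.fib (r + 2) - Nat.fib i * Nat.fib r : ℤ) = Nat.fib (i + r + 2) := by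
  rw [show i + r + 2 = (i + 1) + r + 1 by ring, Nat.fib_add (i + 1) r, Nat.fib_add_two (n := r),
    show i + 1 + 1 = i + 2 by ring, Nat.fib_add_two (n := i)]
  push_cast
  ring

theorem fib_dvd_det {m i r : ℕ} (hm : 0 < m) (hir : i + r = m) {s j k : ℤ}
    (hs : (-1) ^ i = s) (h : (Nat.fib m : ℤ) ∣ k + s * Nat.fib (m - 1) * j) :
    (Nat.fib m : ℤ) ∣ j * Nat.fib r - k * Nat.fib i := by
  obtain ⟨c, hc⟩ := h
  obtain ⟨d, hd⟩ := fib_dvd_fib_add' hm hir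
  rw [hs] at hd
  exact ⟨j * d - c * Nat.fib i, by linear_combination j * hd - Nat.fib i * hc⟩

theorem isSquarePoint_fib {m i r : ℕ} (hm : 3 ≤ m) (hir : i + r = m) (hi : 0 < i) (hr : 0 < r)
    {s : ℤ} (hs : (-1) ^ i = s) :
    IsSquarePoint (Nat.fib m) (s * Nat.fib (m - 1)) (Nat.fib i) (Nat.fib r) := by
  have key : ∀ t, t < m → Nat.fib t < Nat.fib m := fun t ht =>
    (Nat.fib_mono (Nat.le_sub_one_of_lt ht)).trans_lt (by
      obtain ⟨q, rfl⟩ := Nat.exists_eq_add_of_le hm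
      exact Nat.fib_lt_fib_succ (by omega : 2 ≤ 3 + q - 1) |>.trans_eq (by congr 1; omega))
  refine ⟨?_, ?_, ?_, ?_, ?_⟩
  · exact_mod_cast Nat.fib_pos.2 hi
  · exact_mod_cast key i (by omega)
  · exact_mod_cast Nat.fib_pos.2 hr
  · exact_mod_cast key r (by omega)
  · have := fib_dvd_fib_add' (by omega) hir
    rwa [hs] at this

theorem exists_exposing_fib {i r : ℕ} {s : ℤ} (hs : (-1) ^ (i + 1) = s) :
    ∃ γ δ : ℝ, ∀ j k, IsSquarePoint (Nat.fib (i + r + 2)) (s * Nat.fib (i + r + 1)) j k →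
      (j ≠ Nat.fib (i + 1) ∨ k ≠ Nat.fib (r + 1)) →
      γ * (Nat.fib (i + 1) : ℤ) + δ * (Nat.fib (r + 1) : ℤ) < γ * j + δ * k := by
  refine ⟨(Nat.fib r + Nat.fib (r + 2) : ℤ), (Nat.fib (i + 2) + Nat.fib i : ℤ), ?_⟩
  rintro j k ⟨hj, -, hk, -, t, ht⟩ hne
  obtain ⟨c, hc⟩ := fib_dvd_fib_add' (m := i + r + 2) (i := i + 2) (r := r) (by omega) (by omega)
  obtain ⟨d, hd⟩ := fib_dvd_fib_add' (m := i + r + 2) (i := i) (r := r + 2) (by omega) (by omega)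
  have hs2 : (-1 : ℤ) ^ (i + 2) = -s := by rw [← hs]; ring
  have hs0 : (-1 : ℤ) ^ i = -s := by rw [← hs]; ring
  rw [hs2] at hc
  rw [hs0] at hd
  have hsub : i + r + 2 - 1 = i + r + 1 := rfl
  rw [hsub] at hc hd
  have hdet := fib_add_two_mul_sub i r
  have hi2 : (Nat.fib (i + 2) : ℤ) = Nat.fib i + Nat.fib (i + 1) := by
    exact_mod_cast Nat.fib_add_two
  have hr2 : (Nat.fib (r + 2) : ℤ) = Nat.fib r + Nat.fib (r + 1) := by
    exact_mod_cast Nat.fib_add_two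
  have hn : (0 : ℤ) < Nat.fib (i + r + 2) := by exact_mod_cast Nat.fib_pos.2 (by omega)
  have hfi2 : (0 : ℤ) < Nat.fib (i + 2) := by exact_mod_cast Nat.fib_pos.2 (by omega)
  have hfr2 : (0 : ℤ) < Nat.fib (r + 2) := by exact_mod_cast Nat.fib_pos.2 (by omega)
  have hfi : (0 : ℤ) ≤ Nat.fib i := by positivity
  have hfr : (0 : ℤ) ≤ Nat.fib r := by positivity
  generalize (Nat.fib (i + r + 2) : ℤ) = n at *
  generalize (Nat.fib (i + r + 1) : ℤ) = g at *
  generalize (Nat.fib (i + 2) : ℤ) = u2 at *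
  generalize (Nat.fib (r + 2) : ℤ) = w2 at *
  generalize (Nat.fib (i + 1) : ℤ) = u1 at *
  generalize (Nat.fib (r + 1) : ℤ) = w1 at *
  generalize (Nat.fib i : ℤ) = u at *
  generalize (Nat.fib r : ℤ) = w at *
  have hS : j * w + k * u2 = n * (j * c + t * u2) := by linear_combination j * hc + u2 * ht
  have hT : j * w2 + k * u = n * (j * d + t * u) := by linear_combination j * hd + u * ht
  set S := j * c + t * u2
  set T := j * d + t * u
  have hS1 : 1 ≤ S := pos_of_mul_pos_right (hS ▸ by positivity : 0 < n * S) hn.le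
  have hT1 : 1 ≤ T := pos_of_mul_pos_right (hT ▸ by positivity : 0 < n * T) hn.le
  have hlt : 2 < S + T := by
    by_contra! hle
    have hSe : S = 1 := by omega
    have hTe : T = 1 := by omega
    rw [hSe] at hS
    rw [hTe] at hT
    have hjn : n * j = n * u1 := by linear_combination u2 * hT - u * hS - j * hdet + n * hi2
    have hkn : n * k = n * w1 := by linear_combination w2 * hS - w * hT - k * hdet + n * hr2
    have := mul_left_cancel₀ hn.ne' hjn
    have := mul_left_cancel₀ hn.ne' hkn
    omega
  have hfin : (w + w2) * u1 + (u2 + u) * w1 < (w + w2) * j + (u2 + u) * k := by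
    have h2 : (w + w2) * u1 + (u2 + u) * w1 = n * 2 := by
      linear_combination 2 * hdet - (w + w2) * hi2 - (u2 + u) * hr2
    have h3 : (w + w2) * j + (u2 + u) * k = n * (S + T) := by linear_combination hS + hT
    rw [h2, h3]
    exact mul_lt_mul_of_pos_left hlt hn
  exact_mod_cast hfin

theorem eq_fib_of_isMinimizer_of_lt {m : ℕ} (hm : 3 ≤ m) {s j k : ℤ} {α β : ℝ} (hα : 0 ≤ α)
    (hβ : 0 ≤ β) (h0 : α ≠ 0 ∨ β ≠ 0)
    (hp : IsSquarePoint (Nat.fib m) (s * Nat.fib (m - 1)) j k)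
    (hmin : IsMinimizer (Nat.fib m) (s * Nat.fib (m - 1)) α β j k) (i : ℕ) :
    ∀ r, i + r = m → (-1) ^ i = s → j * Nat.fib r < k * Nat.fib i →
    ∃ i r, i + 1 + (r + 1) = m ∧ (-1) ^ (i + 1) = s ∧
      j = Nat.fib (i + 1) ∧ k = Nat.fib (r + 1) := by
  obtain ⟨hj, hjn, hk, hkn, hdvd⟩ := id hp
  have hn : (0 : ℤ) < Nat.fib m := hj.trans hjn
  induction i using Nat.twoStepInduction with
  | zero =>
    intro r _ _ h
    have : 0 ≤ j * Nat.fib r := by positivity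
    simp only [Nat.fib_zero, Nat.cast_zero, mul_zero] at h
    omega
  | one =>
    intro r hr hs h
    obtain ⟨c, hc⟩ := fib_dvd_det (by omega) hr hs hdvd
    have : 0 ≤ j * Nat.fib r := by positivity
    simp only [Nat.fib_one, Nat.cast_one, mul_one] at h hc
    have hc0 : c < 0 := by
      by_contra! hc0
      have := mul_nonneg hn.le hc0
      omega
    nlinarith
  | more i ih _ =>
    intro r hr hs h
    have hs' : (-1) ^ i = s := by rw [← hs]; ring
    rcases lt_or_ge (j * Nat.fib (r + 2) : ℤ) (k * Nat.fib i) with hlt | hge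
    · exact ih (r + 2) (by omega) hs' hlt
    obtain ⟨T, hT⟩ := fib_dvd_det (by omega) (by omega : i + (r + 2) = m) hs' hdvd
    obtain ⟨S, hS⟩ := fib_dvd_det (by omega) hr hs hdvd
    have hdet := fib_add_two_mul_sub i r
    rw [show i + r + 2 = m by omega] at hdet
    have hT0 : 0 ≤ T := by
      by_contra! hneg
      nlinarith
    obtain ⟨U, rfl⟩ : ∃ U, S = -U := ⟨-S, by ring⟩
    have hU0 : 1 ≤ U := by
      by_contra! hneg
      nlinarith
    have hjU : j = U * Nat.fib i + T * Nat.fib (i + 2) := by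
      refine mul_left_cancel₀ hn.ne' ?_
      linear_combination Nat.fib (i + 2) * hT - Nat.fib i * hS - j * hdet
    have hkU : k = U * Nat.fib (r + 2) + T * Nat.fib r := by
      refine mul_left_cancel₀ hn.ne' ?_
      linear_combination Nat.fib r * hT - Nat.fib (r + 2) * hS - k * hdet
    have hfr : (0 : ℤ) ≤ Nat.fib r := by positivity
    have hfi : (0 : ℤ) ≤ Nat.fib i := by positivity
    cases i with
    | zero =>
      obtain rfl : r + 2 = m := by omega
      nlinarith [mul_nonneg hT0 hfr]
    | succ i =>
      have hA := hmin _ _ (isSquarePoint_fib hm (by omega : (i + 1) + (r + 2) = m)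
        (by omega) (by omega) hs')
      have hpos : 0 < α * j + β * k := by
        have hj' : (0 : ℝ) < j := by exact_mod_cast hj
        have hk' : (0 : ℝ) < k := by exact_mod_cast hk
        rcases h0 with h0 | h0
        · have := mul_pos (lt_of_le_of_ne hα h0.symm) hj'
          have := mul_nonneg hβ hk'.le
          linarith
        · have := mul_pos (lt_of_le_of_ne hβ h0.symm) hk'
          have := mul_nonneg hα hj'.le
          linarith
      have hU0' : (1 : ℝ) ≤ U := by exact_mod_cast hU0
      have hT0' : (0 : ℝ) ≤ T := by exact_mod_cast hT0
      have hval : α * j + β * k =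
          U * (α * (Nat.fib (i + 1) : ℤ) + β * (Nat.fib (r + 2) : ℤ)) +
          T * (α * (Nat.fib (i + 1 + 2) : ℤ) + β * (Nat.fib r : ℤ)) := by
        rw [hjU, hkU]
        push_cast
        ring
      have hT1 : T = 0 := by
        rcases r.eq_zero_or_pos with rfl | hr0
        · obtain rfl : i + 1 + 2 = m := by omega
          by_contra hne
          have : 1 ≤ T := by omega
          nlinarith
        · have hB := hmin _ _ (isSquarePoint_fib hm hr (by omega) hr0 hs)
          by_contra hne
          have : 1 ≤ T := by omega
          have : (1 : ℝ) ≤ T := by exact_mod_cast this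
          nlinarith
      subst hT1
      have hU1 : U = 1 := by
        by_contra hne
        have : 2 ≤ U := by omega
        have : (2 : ℝ) ≤ U := by exact_mod_cast this
        simp only [Int.cast_zero, zero_mul, add_zero] at hval
        nlinarith
      subst hU1
      exact ⟨i, r + 1, by omega, hs', by simpa using hjU, by simpa using hkU⟩

theorem eq_fib_of_isMinimizer {m : ℕ} (hm : 3 ≤ m) {s j k : ℤ} (hs : s = 1 ∨ s = -1) {α β : ℝ}
    (hα : 0 ≤ α) (hβ : 0 ≤ β) (h0 : α ≠ 0 ∨ β ≠ 0)
    (hp : IsSquarePoint (Nat.fib m) (s * Nat.fib (m - 1)) j k)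
    (hmin : IsMinimizer (Nat.fib m) (s * Nat.fib (m - 1)) α β j k) :
    ∃ i r, i + 1 + (r + 1) = m ∧ (-1) ^ (i + 1) = s ∧
      j = Nat.fib (i + 1) ∧ k = Nat.fib (r + 1) := by
  obtain ⟨hj, hjn, hk, hkn, hdvd⟩ := id hp
  have hn : (0 : ℤ) < Nat.fib m := hj.trans hjn
  by_cases hpar : (-1) ^ m = s
  · exact eq_fib_of_isMinimizer_of_lt hm hα hβ h0 hp hmin m 0 (by omega) hpar
      (by simpa using mul_pos hk hn)
  obtain ⟨q, rfl⟩ : ∃ q, m = q + 2 := ⟨m - 2, by omega⟩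
  have hs' : (-1) ^ (q + 1) = s := by
    rcases neg_one_pow_eq_or ℤ q with h | h <;> rcases hs with rfl | rfl <;>
      simp_all [pow_succ]
  rcases lt_or_ge (j * Nat.fib 1 : ℤ) (k * Nat.fib (q + 1)) with hlt | hge
  · exact eq_fib_of_isMinimizer_of_lt hm hα hβ h0 hp hmin (q + 1) 1 (by omega) hs' hlt
  obtain ⟨c, hc⟩ := fib_dvd_det (by omega) (by omega : (q + 1) + 1 = q + 2) hs' hdvd
  have hfq : (0 : ℤ) ≤ k * Nat.fib (q + 1) := by positivity
  simp only [Nat.fib_one, Nat.cast_one, mul_one] at hc hge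
  have hc0 : c = 0 := by
    have h1 : 0 ≤ c := by
      by_contra! hneg
      nlinarith
    by_contra hne
    have : 1 ≤ c := by omega
    nlinarith
  subst hc0
  have hA := hmin _ _ (isSquarePoint_fib hm (by omega : (q + 1) + 1 = q + 2) (by omega)
    (by omega) hs')
  have hjk : j = k * Nat.fib (q + 1) := by linarith
  have hk1 : k = 1 := by
    by_contra hne
    have h2 : 2 ≤ k := by omega
    have h2' : (2 : ℝ) ≤ k := by exact_mod_cast h2
    have hfq' : (0 : ℝ) < Nat.fib (q + 1) := by exact_mod_cast Nat.fib_pos.2 (by omega)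
    rw [hjk] at hA
    push_cast [Nat.fib_one] at hA
    have e1 : 0 ≤ α * Nat.fib (q + 1) := by positivity
    rcases h0 with h0 | h0
    · have := mul_pos (lt_of_le_of_ne hα h0.symm) hfq'
      nlinarith
    · have := lt_of_le_of_ne hβ h0.symm
      nlinarith
  subst hk1
  exact ⟨q, 0, by omega, hs', by simpa using hjk, by simp⟩

theorem exists_exposing_of_nonneg {m : ℕ} (hm : 3 ≤ m) {s j k : ℤ} (hs : s = 1 ∨ s = -1)
    {α β : ℝ} (hα : 0 ≤ α) (hβ : 0 ≤ β) (h0 : α ≠ 0 ∨ β ≠ 0)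
    (hp : IsSquarePoint (Nat.fib m) (s * Nat.fib (m - 1)) j k)
    (hmin : IsMinimizer (Nat.fib m) (s * Nat.fib (m - 1)) α β j k) :
    ∃ γ δ : ℝ, ∀ j' k', IsSquarePoint (Nat.fib m) (s * Nat.fib (m - 1)) j' k' →
      (j' ≠ j ∨ k' ≠ k) → γ * j + δ * k < γ * j' + δ * k' := by
  obtain ⟨i, r, rfl, hs', rfl, rfl⟩ := eq_fib_of_isMinimizer hm hs hα hβ h0 hp hmin
  have := exists_exposing_fib (r := r) hs'
  rwa [show i + 1 + (r + 1) = i + r + 2 by ring, show i + r + 2 - 1 = i + r + 1 from rfl]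

theorem exists_exposing_of_left_nonneg {m : ℕ} (hm : 3 ≤ m) {s j k : ℤ}
    (hs : s = 1 ∨ s = -1) {α β : ℝ} (hα : 0 ≤ α) (h0 : α ≠ 0 ∨ β ≠ 0)
    (hp : IsSquarePoint (Nat.fib m) (s * Nat.fib (m - 1)) j k)
    (hmin : IsMinimizer (Nat.fib m) (s * Nat.fib (m - 1)) α β j k) :
    ∃ γ δ : ℝ, ∀ j' k', IsSquarePoint (Nat.fib m) (s * Nat.fib (m - 1)) j' k' →
      (j' ≠ j ∨ k' ≠ k) → γ * j + δ * k < γ * j' + δ * k' := by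
  rcases le_total 0 β with hβ | hβ
  · exact exists_exposing_of_nonneg hm hs hα hβ h0 hp hmin
  have hp' := hp.neg_right
  have hmin' := hmin.neg_right
  rw [← neg_mul] at hp' hmin'
  obtain ⟨γ, δ, h⟩ := exists_exposing_of_nonneg hm (s := -s) (by omega) hα
    (neg_nonneg.2 hβ) (by simpa using h0) hp' hmin'
  refine ⟨γ, -δ, fun j' k' h' hne => ?_⟩
  have h'' := h'.neg_right
  rw [← neg_mul] at h''
  have := h _ _ h'' (by omega)
  push_cast at this ⊢
  linarith

theorem exists_exposing {m : ℕ} (hm : 3 ≤ m) {s j k : ℤ} (hs : s = 1 ∨ s = -1) {α β : ℝ}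
    (h0 : α ≠ 0 ∨ β ≠ 0) (hp : IsSquarePoint (Nat.fib m) (s * Nat.fib (m - 1)) j k)
    (hmin : IsMinimizer (Nat.fib m) (s * Nat.fib (m - 1)) α β j k) :
    ∃ γ δ : ℝ, ∀ j' k', IsSquarePoint (Nat.fib m) (s * Nat.fib (m - 1)) j' k' →
      (j' ≠ j ∨ k' ≠ k) → γ * j + δ * k < γ * j' + δ * k' := by
  rcases le_total 0 α with hα | hα
  · exact exists_exposing_of_left_nonneg hm hs hα h0 hp hmin
  obtain ⟨γ, δ, h⟩ := exists_exposing_of_left_nonneg hm hs (neg_nonneg.2 hα)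
    (by simpa using h0) hp.symm hmin.symm
  refine ⟨-γ, -δ, fun j' k' h' hne => ?_⟩
  have := h _ _ h'.symm (by omega)
  push_cast at this ⊢
  linarith

theorem isSquarePoint_congr {n a b : ℤ} (h : n ∣ a - b) (j k : ℤ) :
    IsSquarePoint n a j k ↔ IsSquarePoint n b j k := by
  have : n ∣ k + a * j ↔ n ∣ k + b * j := by
    rw [show k + a * j = (k + b * j) + (a - b) * j by ring]
    exact dvd_add_left (h.mul_right j)
  simp only [IsSquarePoint, this]

theorem exists_sign_dvd_sub {m a : ℕ} (hm : 3 ≤ m)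
    (ha : a = Nat.fib (m - 1) ∨ a = Nat.fib (m - 2)) :
    ∃ s : ℤ, (s = 1 ∨ s = -1) ∧ (Nat.fib m : ℤ) ∣ a - s * Nat.fib (m - 1) := by
  rcases ha with rfl | rfl
  · exact ⟨1, Or.inl rfl, by simp⟩
  · obtain ⟨q, rfl⟩ : ∃ q, m = q + 2 := ⟨m - 2, by omega⟩
    refine ⟨-1, Or.inr rfl, 1, ?_⟩
    simp [Nat.fib_add_two]

/-- The interior hull of `P_{a,n}` is clean (every lattice point on its boundary is an
extreme point) if and only if `n = F_m` and `a = F_{m-1}` or `a = F_{m-2}` for some index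
`m`, where `F` is the Fibonacci sequence with `F_1 = F_2 = 1`. -/
theorem stmt_19 (a n : ℕ) (ha : 0 < a) (han : a < n) (hn : 1 < n)
    (hco : Nat.Coprime a n) :
    (∀ p ∈ frontier (convexHull ℝ (interior (Pan a n) ∩ latt)), p ∈ latt →
        p ∈ Set.extremePoints ℝ (convexHull ℝ (interior (Pan a n) ∩ latt))) ↔
      ∃ m : ℕ, n = Nat.fib m ∧ (a = Nat.fib (m - 1) ∨ a = Nat.fib (m - 2)) := by
  have hn0 : 0 < n := by omega
  constructor
  · intro hclean
    exact NoFlatPoint.exists_eq_fib ha han hco fun j k d e hp α β h0 hmin h1 h2 =>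
      eq_of_clean hn0 hclean hp h0 hmin h1 h2
  · rintro ⟨m, rfl, hm⟩
    have hm3 : 3 ≤ m := by
      by_contra! h
      interval_cases m <;> simp at hn
    obtain ⟨s, hs, hdvd⟩ := exists_sign_dvd_sub hm3 hm
    refine clean_of_forall_exposed hn0 fun j k hp α β h0 hmin => ?_
    simp only [IsMinimizer, isSquarePoint_congr hdvd] at hp hmin ⊢
    exact exists_exposing hm3 hs h0 hp hmin
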